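/- Let a_n = γ_n / γ_{n-1} be the recurrence coefficients. There exist a constant C > 0 and an integer N such that for every even integer n > N: |q^{-(n-1+α)} a_n − 1| ≤ C q^n; that is, a_n = q^{n-1+α}(1 + O(q^n)) as n → ∞ through even integers. -/

import Mathlib

open Polynomial

noncomputable def baseG (A Q : ℝ) (m : ℕ) : ℝ :=
  (∏ j ∈ Finset.range m, A * (Q ^ m - Q ^ j) ^ 2 / (1 - A * Q ^ (m + j)) ^ 2) /
    (1 - A * Q ^ (m + m))

lemma one_sub_pos' {A Q : ℝ} (hA0 : 0 < A) (hA1 : A < 1) (hQ0 : 0 < Q) (hQ1 : Q < 1) (j : ℕ) :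
    0 < 1 - A * Q ^ j := by
  have h1 : Q ^ j ≤ 1 := pow_le_one₀ hQ0.le hQ1.le
  have h2 : 0 < Q ^ j := pow_pos hQ0 j
  nlinarith

lemma baseG_pos {A Q : ℝ} (hA0 : 0 < A) (hA1 : A < 1) (hQ0 : 0 < Q) (hQ1 : Q < 1) (m : ℕ) :
    0 < baseG A Q m := by
  unfold baseG
  refine div_pos (Finset.prod_pos ?_) (one_sub_pos' hA0 hA1 hQ0 hQ1 _)
  intro j hj
  have h1 := one_sub_pos' hA0 hA1 hQ0 hQ1 (m + j)
  have h2 : Q ^ m < Q ^ j := pow_lt_pow_right_of_lt_one₀ hQ0 hQ1 (Finset.mem_range.1 hj)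
  have h3 : 0 < (Q ^ m - Q ^ j) ^ 2 := by
    apply sq_pos_of_neg; linarith
  positivity

lemma baseG_ratio {A Q : ℝ} (hA0 : 0 < A) (hA1 : A < 1) (hQ0 : 0 < Q) (hQ1 : Q < 1) (m : ℕ) :
    baseG A Q (m + 1) = baseG (A * Q) Q m * (A * Q ^ m * (1 - Q ^ (m + 1)) ^ 2 /
      ((1 - A * Q ^ (2 * m + 1)) * (1 - A * Q ^ (2 * m + 2)))) := by
  unfold baseG
  have e1 : ∀ j, (1 - A * Q * Q ^ j) = 1 - A * Q ^ (j + 1) := fun j => by ring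
  simp only [e1, Finset.prod_div_distrib, Finset.prod_mul_distrib, Finset.prod_const,
    Finset.card_range]
  rw [Finset.prod_range_succ' (fun j => (Q ^ (m + 1) - Q ^ j) ^ 2), Finset.prod_range_succ
    (fun j => (1 - A * Q ^ (m + 1 + j)) ^ 2)]
  have e2 : ∀ j, (Q ^ (m + 1) - Q ^ (j + 1)) ^ 2 = Q ^ 2 * (Q ^ m - Q ^ j) ^ 2 := fun j => by ring
  simp only [e2, Finset.prod_mul_distrib, Finset.prod_const, Finset.card_range]
  have e3 : ∀ j, m + 1 + j = m + j + 1 := fun j => by ring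
  simp only [e3]
  have e4 : m + (m + 1) + 1 = 2 * m + 2 := by ring
  have e5 : m + m + 1 = 2 * m + 1 := by ring
  rw [e4, e5]
  have p1 := (one_sub_pos' hA0 hA1 hQ0 hQ1 (2 * m + 1)).ne'
  have p2 := (one_sub_pos' hA0 hA1 hQ0 hQ1 (2 * m + 2)).ne'
  have p3 : (∏ j ∈ Finset.range m, (1 - A * Q ^ (m + j + 1)) ^ 2) ≠ 0 :=
    Finset.prod_ne_zero_iff.2 fun j _ => pow_ne_zero _ (one_sub_pos' hA0 hA1 hQ0 hQ1 _).ne'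
  field_simp
  ring

lemma cauchyCoef {A Q : ℝ} (hA0 : 0 < A) (hA1 : A < 1) (hQ0 : 0 < Q) (hQ1 : Q < 1) (m : ℕ) :
    ∃ c : ℕ → ℝ, c m = 1 ∧
      (∀ l < m, ∑ j ∈ Finset.range (m + 1), c j / (1 - A * Q ^ (j + l)) = 0) ∧
      ∑ j ∈ Finset.range (m + 1), c j / (1 - A * Q ^ (j + m)) = baseG A Q m := by
  classical
  set z : ℕ → ℝ := fun j => (A * Q ^ j)⁻¹ with hz
  set s := Finset.range (m + 1) with hs
  set N : ℝ[X] := ∏ i ∈ Finset.range m, (X - C (Q ^ i)) with hN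
  have hz1 : ∀ j, 1 < z j := by
    intro j
    have := one_sub_pos' hA0 hA1 hQ0 hQ1 j
    have h2 : 0 < A * Q ^ j := by positivity
    exact (one_lt_inv₀ h2).2 (by linarith)
  have hzpos : ∀ j, 0 < z j := fun j => by linarith [hz1 j]
  have hQle : ∀ j, Q ^ j ≤ 1 := fun j => pow_le_one₀ hQ0.le hQ1.le
  have hzQ : ∀ i j, Q ^ i - z j ≠ 0 := fun i j => by
    have := hz1 j; have := hQle i; intro h; linarith
  have hinj : Function.Injective z := by
    intro i j hij
    simp only [hz] at hij
    have h1 := inv_injective hij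
    have h2 := mul_left_cancel₀ hA0.ne' h1
    exact pow_right_injective₀ hQ0 hQ1.ne h2
  have hNev : ∀ x, N.eval x = ∏ i ∈ Finset.range m, (x - Q ^ i) := by
    intro x; simp [hN, eval_prod]
  have hNdeg : N.degree < s.card := by
    rw [hN, degree_prod]
    simp only [degree_X_sub_C, Finset.sum_const, Finset.card_range, hs, nsmul_eq_mul, mul_one]
    exact_mod_cast Nat.lt_succ_self m
  have hint := Lagrange.eq_interpolate (s := s) (v := z) (hinj.injOn) hNdeg
  have key : ∀ l, N.eval (Q ^ l) = (Lagrange.nodal s z).eval (Q ^ l) *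
      ∑ i ∈ s, Lagrange.nodalWeight s z i * (Q ^ l - z i)⁻¹ * N.eval (z i) := by
    intro l
    rw [← Lagrange.eval_interpolate_not_at_node]
    · rw [← hint]
    · intro i _ h
      exact hzQ l i (by rw [h]; ring)
  have hnod : ∀ l, (Lagrange.nodal s z).eval (Q ^ l) ≠ 0 := by
    intro l
    rw [Lagrange.eval_nodal]
    exact Finset.prod_ne_zero_iff.2 fun j _ => hzQ l j
  have hms : m ∈ s := by simp [hs]
  have hWm : Lagrange.nodalWeight s z m ≠ 0 := Lagrange.nodalWeight_ne_zero hinj.injOn hms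
  have hNm : N.eval (z m) ≠ 0 := by
    rw [hNev]
    refine Finset.prod_ne_zero_iff.2 fun j _ => ?_
    have := hzQ j m
    intro h; apply this; linarith
  set κ := z m / (Lagrange.nodalWeight s z m * N.eval (z m)) with hκ
  have hsum : ∀ l, ∑ j ∈ s, (κ * Lagrange.nodalWeight s z j * N.eval (z j) / z j) /
      (1 - A * Q ^ (j + l)) = - κ * N.eval (Q ^ l) / (Lagrange.nodal s z).eval (Q ^ l) := by
    intro l
    rw [key l, mul_div_assoc, mul_div_cancel_left₀ _ (hnod l), Finset.mul_sum]
    refine Finset.sum_congr rfl fun j _ => ?_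
    have h1 : 1 - A * Q ^ (j + l) = - (Q ^ l - z j) / z j := by
      simp only [hz]
      have : A * Q ^ j ≠ 0 := by positivity
      field_simp
      ring
    rw [h1]
    have h2 := hzQ l j
    have h3 := (hzpos j).ne'
    field_simp
  refine ⟨fun j => κ * Lagrange.nodalWeight s z j * N.eval (z j) / z j, ?_, ?_, ?_⟩
  · have h3 := (hzpos m).ne'
    simp only [hκ]
    field_simp
  · intro l hl
    rw [hsum]
    have : N.eval (Q ^ l) = 0 := by
      rw [hNev]
      exact Finset.prod_eq_zero (Finset.mem_range.2 hl) (by ring)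
    rw [this]; simp
  · rw [hsum, hκ, Lagrange.eval_nodal, hNev, hNev, Lagrange.nodalWeight]
    have he : s.erase m = Finset.range m := by
      rw [hs, Finset.range_add_one, Finset.erase_insert (by simp)]
    rw [he, hs, Finset.prod_range_succ, baseG]
    have e0 : 1 - A * Q ^ (m + m) = - (Q ^ m - z m) / z m := by
      simp only [hz]
      have : A * Q ^ m ≠ 0 := by positivity
      field_simp
      ring
    have e1 : ∀ j ∈ Finset.range m, A * (Q ^ m - Q ^ j) ^ 2 / (1 - A * Q ^ (m + j)) ^ 2 =
        ((z m - z j)  * (Q ^ m - Q ^ j)) * ((z m - Q ^ j)⁻¹  * (Q ^ m - z j)⁻¹) := by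
      intro j _
      have p := (one_sub_pos' hA0 hA1 hQ0 hQ1 (m + j)).ne'
      have f1 : z m - Q ^ j = (1 - A * Q ^ (m + j)) / (A * Q ^ m) := by
        simp only [hz]; field_simp; ring
      have f2 : Q ^ m - z j = -(1 - A * Q ^ (m + j)) / (A * Q ^ j) := by
        simp only [hz]; field_simp; ring
      have f3 : z m - z j = (Q ^ j - Q ^ m) / (A * Q ^ m * Q ^ j) := by
        simp only [hz]; field_simp
      rw [f1, f2, f3]
      field_simp
      ring
    rw [Finset.prod_congr rfl e1, e0]
    simp only [Finset.prod_mul_distrib, Finset.prod_inv_distrib]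
    have g1 := (hzpos m).ne'
    have g2 := hzQ m m
    have g3 : ∏ j ∈ Finset.range m, (Q ^ m - z j) ≠ 0 :=
      Finset.prod_ne_zero_iff.2 fun j _ => hzQ m j
    have g4 : ∏ j ∈ Finset.range m, (z m - Q ^ j) ≠ 0 := by rw [← hNev]; exact hNm
    have g5 : ∏ j ∈ Finset.range m, (z m - z j) ≠ 0 :=
      Finset.prod_ne_zero_iff.2 fun j hj h => by
        have := hinj (sub_eq_zero.1 h)
        simp at hj; omega
    field_simp

section pert
variable {ι : Type*}

def Bd (f : ι → ℂ) : Prop := ∃ B, ∀ i, ‖f i‖ ≤ B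

lemma Bd.mul {f g : ι → ℂ} (hf : Bd f) (hg : Bd g) : Bd (fun i => f i * g i) := by
  obtain ⟨B, hB⟩ := hf
  obtain ⟨D, hD⟩ := hg
  refine ⟨B * D, fun i => ?_⟩
  rw [norm_mul]
  exact mul_le_mul (hB i) (hD i) (norm_nonneg _) ((norm_nonneg _).trans (hB i))

lemma Bd.add {f g : ι → ℂ} (hf : Bd f) (hg : Bd g) : Bd (fun i => f i + g i) := by
  obtain ⟨B, hB⟩ := hf
  obtain ⟨D, hD⟩ := hg
  exact ⟨B + D, fun i => (norm_add_le _ _).trans (add_le_add (hB i) (hD i))⟩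

lemma Bd.sub {f g : ι → ℂ} (hf : Bd f) (hg : Bd g) : Bd (fun i => f i - g i) := by
  obtain ⟨B, hB⟩ := hf
  obtain ⟨D, hD⟩ := hg
  exact ⟨B + D, fun i => (norm_sub_le _ _).trans (add_le_add (hB i) (hD i))⟩

lemma Bd.const (c : ℂ) : Bd (fun _ : ι => c) := ⟨‖c‖, fun _ => le_rfl⟩

lemma Bd.conj {f : ι → ℂ} (hf : Bd f) : Bd (fun i => star (f i)) := by
  obtain ⟨B, hB⟩ := hf
  exact ⟨B, fun i => by simpa using hB i⟩

lemma Bd.pow {f : ι → ℂ} (hf : Bd f) (n : ℕ) : Bd (fun i => f i ^ n) := by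
  induction n with
  | zero => simpa using Bd.const 1
  | succ n ih => simpa [pow_succ] using ih.mul hf

lemma Bd.poly {f : ι → ℂ} (hf : Bd f) (P : ℂ[X]) : Bd (fun i => P.eval (f i)) := by
  induction P using Polynomial.induction_on' with
  | add p r hp hr => simpa using hp.add hr
  | monomial n a => simpa using (Bd.const a).mul (hf.pow n)

noncomputable def EE (μ : ι → ℝ) (f : ι → ℂ) : ℂ := ∑' i, f i * (μ i : ℂ)
noncomputable def NN (μ : ι → ℝ) (f : ι → ℂ) : ℝ := ∑' i, ‖f i‖ ^ 2 * μ i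


lemma Bd.summ {μ : ι → ℝ} (h0 : ∀ i, 0 ≤ μ i) (hμ : Summable μ)
    {f : ι → ℂ} (hf : Bd f) : Summable (fun i => f i * (μ i : ℂ)) := by
  obtain ⟨B, hB⟩ := hf
  refine Summable.of_norm_bounded (hμ.mul_left B) fun i => ?_
  rw [norm_mul, Complex.norm_real, Real.norm_of_nonneg (h0 i)]
  exact mul_le_mul_of_nonneg_right (hB i) (h0 i)

lemma Bd.summN {μ : ι → ℝ} (h0 : ∀ i, 0 ≤ μ i) (hμ : Summable μ)
    {f : ι → ℂ} (hf : Bd f) : Summable (fun i => ‖f i‖ ^ 2 * μ i) := by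
  obtain ⟨B, hB⟩ := hf
  refine Summable.of_nonneg_of_le (fun i => mul_nonneg (by positivity) (h0 i)) (fun i => ?_)
    (hμ.mul_left (B ^ 2))
  exact mul_le_mul_of_nonneg_right (pow_le_pow_left₀ (norm_nonneg _) (hB i) 2) (h0 i)

lemma NN_nonneg {μ : ι → ℝ} (h0 : ∀ i, 0 ≤ μ i) (f : ι → ℂ) : 0 ≤ NN μ f :=
  tsum_nonneg fun i => mul_nonneg (by positivity) (h0 i)

lemma EE_add {μ : ι → ℝ} (h0 : ∀ i, 0 ≤ μ i) (hμ : Summable μ)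
    {f g : ι → ℂ} (hf : Bd f) (hg : Bd g) :
    EE μ (fun i => f i + g i) = EE μ f + EE μ g := by
  unfold EE
  rw [← Summable.tsum_add (hf.summ h0 hμ) (hg.summ h0 hμ)]
  exact tsum_congr fun i => by ring

lemma EE_smul {μ : ι → ℝ} (c : ℂ) {f : ι → ℂ} :
    EE μ (fun i => c * f i) = c * EE μ f := by
  unfold EE
  rw [← tsum_mul_left]
  exact tsum_congr fun i => by ring

lemma EE_conj {μ : ι → ℝ} (f : ι → ℂ) : EE μ (fun i => star (f i)) = star (EE μ f) := by
  unfold EE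
  rw [tsum_star]
  exact tsum_congr fun i => by simp

lemma EE_cs {μ : ι → ℝ} (h0 : ∀ i, 0 ≤ μ i) (hμ : Summable μ)
    {h a b : ι → ℂ} (ha : Bd a) (hb : Bd b) {K : ℝ} (hK : 0 ≤ K)
    (hh : ∀ i, ‖h i‖ ≤ K * (‖a i‖ * ‖b i‖)) :
    ‖EE μ h‖ ≤ K * (√(NN μ a) * √(NN μ b)) := by
  have hs : Summable (fun i => (‖a i‖ * ‖b i‖) * μ i) := by
    have := (ha.mul hb).summ h0 hμ |>.norm
    simpa [abs_of_nonneg (h0 _)] using this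
  have h1 : ‖EE μ h‖ ≤ ∑' i, K * ((‖a i‖ * ‖b i‖) * μ i) := by
    refine tsum_of_norm_bounded (hs.mul_left K).hasSum fun i => ?_
    rw [norm_mul, Complex.norm_real, Real.norm_of_nonneg (h0 i), ← mul_assoc]
    exact mul_le_mul_of_nonneg_right (hh i) (h0 i)
  rw [tsum_mul_left] at h1
  refine h1.trans (mul_le_mul_of_nonneg_left ?_ hK)
  refine Real.tsum_le_of_sum_le (fun i => mul_nonneg (by positivity) (h0 i)) fun s => ?_
  have h2 : ∑ i ∈ s, (‖a i‖ * ‖b i‖) * μ i = ∑ i ∈ s, √(‖a i‖ ^ 2 * μ i) * √(‖b i‖ ^ 2 * μ i) := by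
    refine Finset.sum_congr rfl fun i _ => ?_
    rw [Real.sqrt_mul (by positivity), Real.sqrt_mul (by positivity), Real.sqrt_sq (norm_nonneg _),
      Real.sqrt_sq (norm_nonneg _)]
    have := Real.mul_self_sqrt (h0 i)
    calc _ = ‖a i‖ * ‖b i‖ * (√(μ i) * √(μ i)) := by rw [this]
      _ = _ := by ring
  rw [h2]
  refine (Real.sum_sqrt_mul_sqrt_le s (fun i => mul_nonneg (by positivity) (h0 i))
    (fun i => mul_nonneg (by positivity) (h0 i))).trans ?_
  refine mul_le_mul (Real.sqrt_le_sqrt ?_) (Real.sqrt_le_sqrt ?_) (Real.sqrt_nonneg _)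
    (Real.sqrt_nonneg _)
  · exact (ha.summN h0 hμ).sum_le_tsum s fun i _ => mul_nonneg (by positivity) (h0 i)
  · exact (hb.summN h0 hμ).sum_le_tsum s fun i _ => mul_nonneg (by positivity) (h0 i)

lemma orth_poly {μ : ι → ℝ} (h0 : ∀ i, 0 ≤ μ i) (hμ : Summable μ)
    {f x : ι → ℂ} (hf : Bd f) (hx : Bd x) {n : ℕ}
    (h : ∀ j < n, EE μ (fun i => f i * x i ^ j) = 0) (R : ℂ[X]) (hR : R.degree < n) :
    EE μ (fun i => f i * R.eval (x i)) = 0 := by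
  have e : ∀ i, f i * R.eval (x i) * (μ i : ℂ) =
      ∑ j ∈ Finset.range n, R.coeff j * (f i * x i ^ j * (μ i : ℂ)) := by
    intro i
    by_cases hR0 : R = 0
    · simp [hR0]
    have hn : R.natDegree < n := (natDegree_lt_iff_degree_lt hR0).2 hR
    rw [eval_eq_sum_range' hn, Finset.mul_sum, Finset.sum_mul]
    exact Finset.sum_congr rfl fun j _ => by ring
  unfold EE
  simp_rw [e]
  rw [Summable.tsum_finsetSum]
  · refine Finset.sum_eq_zero fun j hj => ?_
    rw [tsum_mul_left]
    have := h j (Finset.mem_range.1 hj)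
    unfold EE at this
    rw [this, mul_zero]
  · intro j _
    exact ((hf.mul (hx.pow j)).summ h0 hμ).mul_left _

lemma perturb {μ : ι → ℝ} (h0 : ∀ i, 0 ≤ μ i) (hμ : Summable μ)
    {x : ι → ℝ} (hx : ∀ i, |x i| ≤ 1) {u : ι → ℂ} (hu : ∀ i, u i ≠ 0) (ub : Bd u)
    {K : ℝ} (hK0 : 0 ≤ K) (hK : ∀ i, ‖1 - (u i)⁻¹‖ ≤ K * x i ^ 2) {ε : ℝ} (hε0 : 0 ≤ ε)
    (hε : K * ε ≤ 1 / 2) {n : ℕ}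
    (hM : ∀ f : ι → ℂ, Bd f → (∀ j < n, EE μ (fun i => f i * (x i : ℂ) ^ j) = 0) →
      NN μ (fun i => x i * f i) ≤ ε * NN μ f)
    {P : ℂ[X]} (hPm : P.Monic) (hPd : P.natDegree = n)
    {P0 : ℝ[X]} (hP0m : P0.Monic) (hP0d : P0.natDegree = n)
    (hP : ∀ j < n, EE μ (fun i => (u i * P.eval (x i : ℂ)) * (x i : ℂ) ^ j) = 0)
    (hP0 : ∀ j < n, EE μ (fun i => ((P0.eval (x i) : ℝ) : ℂ) * (x i : ℂ) ^ j) = 0)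
    {γ : ℂ} (hγ : EE μ (fun i => (u i * P.eval (x i : ℂ)) * P.eval (x i : ℂ)) = γ)
    {g : ℝ} (hg : EE μ (fun i => ((P0.eval (x i) : ℝ) : ℂ) * (P0.eval (x i) : ℝ)) = g) :
    ‖γ - g‖ ≤ 2 * K * ε * g := by
  set X' : ι → ℂ := fun i => (x i : ℂ) with hX'
  have bx : Bd X' := ⟨1, fun i => by simpa [hX'] using hx i⟩
  set p : ι → ℂ := fun i => P.eval (x i : ℂ) with hp
  set p0 : ι → ℂ := fun i => ((P0.eval (x i) : ℝ) : ℂ) with hp0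
  set Q0 : ℂ[X] := P0.map (algebraMap ℝ ℂ) with hQ0
  have hQe : ∀ i, Q0.eval (X' i) = p0 i := by
    intro i
    simp only [hQ0, hX', hp0]
    exact Polynomial.eval_map_algebraMap P0 (x i : ℂ) |>.trans
      (Polynomial.aeval_algebraMap_apply_eq_algebraMap_eval (x i) P0)
  have bp : Bd p := bx.poly P
  have bp0 : Bd p0 := by
    have := bx.poly Q0
    simpa [hQe] using this
  set D : ℂ[X] := P - Q0 with hD
  have hDdeg : D.degree < n := by
    have hQm : Q0.Monic := hP0m.map _
    have d1 : P.degree = n := by rw [degree_eq_natDegree hPm.ne_zero, hPd]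
    have d2 : Q0.degree = n := by
      rw [degree_eq_natDegree hQm.ne_zero, hQ0, natDegree_map, hP0d]
    have := degree_sub_lt_left (d1.trans d2.symm) hPm.ne_zero (by rw [hPm.leadingCoeff, hQm.leadingCoeff])
    rwa [d1] at this
  set d : ι → ℂ := fun i => D.eval (X' i) with hd
  have bd : Bd d := bx.poly D
  have hpd : ∀ i, p i = p0 i + d i := by
    intro i
    simp only [hd, hD, eval_sub, hQe, hp]
    simp [hX']
  set f : ι → ℂ := fun i => u i * p i with hf
  have bf : Bd f := ub.mul bp
  have hfp : ∀ i, f i = p i + (1 - (u i)⁻¹) * f i := by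
    intro i
    simp only [hf]
    have := hu i
    field_simp
    ring
  have bv : Bd (fun i => 1 - (u i)⁻¹) := ⟨K, fun i => (hK i).trans (by
    have : x i ^ 2 ≤ 1 := by
      have := hx i
      rw [← sq_abs]; nlinarith [abs_nonneg (x i)]
    nlinarith)⟩
  have bvf := bv.mul bf
  have bcf : Bd (fun i => star (f i)) := bf.conj
  have ofd : EE μ (fun i => f i * d i) = 0 := orth_poly h0 hμ bf bx hP D hDdeg
  have ocf : EE μ (fun i => star (f i) * d i) = 0 := by
    refine orth_poly h0 hμ bcf bx ?_ D hDdeg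
    intro j hj
    have := congrArg star (hP j hj)
    rw [← EE_conj] at this
    simpa [hX', hf, hp] using this
  have op0 : EE μ (fun i => p0 i * d i) = 0 := orth_poly h0 hμ bp0 bx hP0 D hDdeg
  have ofX := hM f bf hP
  have opX := hM p0 bp0 hP0
  set a := NN μ f with ha
  set b := NN μ p0 with hb
  have a0 : 0 ≤ a := NN_nonneg h0 f
  have b0 : 0 ≤ b := NN_nonneg h0 p0
  have hgb : g = b := by
    have : (g : ℂ) = (b : ℂ) := by
      rw [← hg, hb]
      unfold EE NN
      rw [Complex.ofReal_tsum]
      refine tsum_congr fun i => ?_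
      simp only [hp0, Complex.norm_real, Real.norm_eq_abs, sq_abs]
      push_cast; ring
    exact_mod_cast this
  have hXb : ∀ {f : ι → ℂ}, Bd f → Bd (fun i => (x i : ℂ) * f i) := fun h => bx.mul h
  -- key norms
  have sfX : √(NN μ (fun i => x i * f i)) ≤ √ε * √a := by
    rw [← Real.sqrt_mul hε0]; exact Real.sqrt_le_sqrt ofX
  have spX : √(NN μ (fun i => x i * p0 i)) ≤ √ε * √b := by
    rw [← Real.sqrt_mul hε0]; exact Real.sqrt_le_sqrt opX
  have see : √ε * √ε = ε := Real.mul_self_sqrt hε0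
  have saa : √a * √a = a := Real.mul_self_sqrt a0
  have sbb : √b * √b = b := Real.mul_self_sqrt b0
  have sa0 := Real.sqrt_nonneg a
  have sb0 := Real.sqrt_nonneg b
  have hxx : ∀ i, K * x i ^ 2 = K * (‖(x i : ℂ)‖ * ‖(x i : ℂ)‖) := by
    intro i; rw [Complex.norm_real, Real.norm_eq_abs, abs_mul_abs_self]; ring
  have c1 : ‖EE μ (fun i => star (f i) * p0 i)‖ ≤ 1 * (√a * √b) :=
    EE_cs h0 hμ bf bp0 zero_le_one fun i => by simp
  have c2 : ‖EE μ (fun i => star (f i) * ((1 - (u i)⁻¹) * f i))‖ ≤ K * (√(NN μ (fun i => x i * f i))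
      * √(NN μ (fun i => x i * f i))) :=
    EE_cs h0 hμ (hXb bf) (hXb bf) hK0 fun i => by
      have := hK i
      rw [hxx] at this
      simp only [norm_mul, norm_star]
      calc ‖f i‖ * (‖1 - (u i)⁻¹‖ * ‖f i‖) = ‖1 - (u i)⁻¹‖ * (‖f i‖ * ‖f i‖) := by ring
        _ ≤ (K * (‖(x i : ℂ)‖ * ‖(x i : ℂ)‖)) * (‖f i‖ * ‖f i‖) := by gcongr
        _ = _ := by ring
  have c3 : ‖EE μ (fun i => p0 i * ((1 - (u i)⁻¹) * f i))‖ ≤ K * (√(NN μ (fun i => x i * p0 i))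
      * √(NN μ (fun i => x i * f i))) :=
    EE_cs h0 hμ (hXb bp0) (hXb bf) hK0 fun i => by
      have := hK i
      rw [hxx] at this
      simp only [norm_mul]
      calc ‖p0 i‖ * (‖1 - (u i)⁻¹‖ * ‖f i‖) = ‖1 - (u i)⁻¹‖ * (‖p0 i‖ * ‖f i‖) := by ring
        _ ≤ (K * (‖(x i : ℂ)‖ * ‖(x i : ℂ)‖)) * (‖p0 i‖ * ‖f i‖) := by gcongr
        _ = _ := by ring
  have ea : (a : ℂ) = EE μ (fun i => star (f i) * p0 i) +
      EE μ (fun i => star (f i) * ((1 - (u i)⁻¹) * f i)) := by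
    have e1 : (a : ℂ) = EE μ (fun i => (star (f i) * p0 i + star (f i) * d i) +
        star (f i) * ((1 - (u i)⁻¹) * f i)) := by
      rw [ha]
      unfold EE NN
      rw [Complex.ofReal_tsum]
      refine tsum_congr fun i => ?_
      beta_reduce
      rw [← mul_add, ← mul_add, ← hpd, ← hfp]
      push_cast
      rw [← Complex.conj_mul']
      rfl
    rw [e1, EE_add h0 hμ ((bcf.mul bp0).add (bcf.mul bd)) (bcf.mul bvf),
      EE_add h0 hμ (bcf.mul bp0) (bcf.mul bd), ocf, add_zero]
  have ba : a ≤ √a * √b + K * (ε * a) := by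
    have h1 : a = ‖(a : ℂ)‖ := by rw [Complex.norm_real, Real.norm_of_nonneg a0]
    have h2 : a ≤ ‖EE μ (fun i => star (f i) * p0 i)‖ +
      ‖EE μ (fun i => star (f i) * ((1 - (u i)⁻¹) * f i))‖ := by
      calc a = ‖(a : ℂ)‖ := h1
        _ ≤ _ := by rw [ea]; exact norm_add_le _ _
    refine h2.trans (add_le_add (by simpa using c1) (c2.trans ?_))
    refine mul_le_mul_of_nonneg_left ?_ hK0
    calc _ ≤ (√ε * √a) * (√ε * √a) := by gcongr
      _ = (√ε * √ε) * (√a * √a) := by ring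
      _ = ε * a := by rw [see, saa]
  have hab : √a ≤ 2 * √b := by
    by_contra hcon
    push Not at hcon
    have : √a * √a ≤ 2 * (√a * √b) := by
      rw [saa]; nlinarith
    nlinarith
  have eγ : γ = g + EE μ (fun i => p0 i * ((1 - (u i)⁻¹) * f i)) := by
    have e1 : γ = EE μ (fun i => f i * p0 i + f i * d i) := by
      rw [← hγ]
      congr 1
      funext i
      rw [← mul_add, ← hpd]
    rw [e1, EE_add h0 hμ (bf.mul bp0) (bf.mul bd), ofd, add_zero]
    have e2 : (fun i => f i * p0 i) = fun i => (p0 i * p0 i + p0 i * d i) +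
        p0 i * ((1 - (u i)⁻¹) * f i) := by
      funext i
      rw [← mul_add, ← mul_add, ← hpd, ← hfp]; ring
    rw [e2, EE_add h0 hμ ((bp0.mul bp0).add (bp0.mul bd)) (bp0.mul bvf),
      EE_add h0 hμ (bp0.mul bp0) (bp0.mul bd), op0, add_zero, ← hg]
  rw [eγ, add_sub_cancel_left, hgb]
  refine c3.trans ?_
  calc _ ≤ K * ((√ε * √b) * (√ε * √a)) := by gcongr
    _ = K * ((√ε * √ε) * (√b * √a)) := by ring
    _ ≤ K * (ε * (√b * (2 * √b))) := by rw [see]; gcongr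
    _ = 2 * K * ε * (√b * √b) := by ring
    _ = _ := by rw [sbb]
end pert

noncomputable def nd (q : ℝ) (i : ℕ × Bool) : ℝ := (if i.2 then 1 else -1) * q ^ i.1
noncomputable def ms (A : ℝ) (i : ℕ × Bool) : ℝ := A ^ i.1

lemma nd_sq (q : ℝ) (i : ℕ × Bool) : nd q i ^ 2 = (q ^ 2) ^ i.1 := by
  unfold nd
  split_ifs <;> ring

lemma nd_abs {q : ℝ} (hq0 : 0 < q) (i : ℕ × Bool) : |nd q i| = q ^ i.1 := by
  unfold nd
  split_ifs <;> simp [abs_of_pos hq0]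

lemma summ_bool {g : ℕ → ℝ} (hg : Summable g) :
    Summable (fun i : ℕ × Bool => g i.1) := by
  have h := hg.norm.mul_of_nonneg (g := fun _ : Bool => (1 : ℝ)) (Summable.of_finite)
    (fun _ => norm_nonneg _) (fun _ => zero_le_one)
  refine Summable.of_norm ?_
  simpa using h

lemma tsum_bool' {E : Type*} [NormedAddCommGroup E] [CompleteSpace E] {g : ℕ × Bool → E}
    (hg : Summable g) :
    ∑' i : ℕ × Bool, g i = ∑' k, (g (k, true) + g (k, false)) := by
  rw [hg.tsum_prod]
  refine tsum_congr fun k => ?_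
  rw [tsum_fintype, Fintype.sum_bool]

lemma ms_summable {A : ℝ} (hA0 : 0 < A) (hA1 : A < 1) : Summable (ms A) :=
  summ_bool (summable_geometric_of_lt_one hA0.le hA1)

lemma prod_lower {Q : ℝ} (hQ0 : 0 < Q) (hQ1 : Q < 1) :
    ∃ δ : ℝ, 0 < δ ∧ ∀ N : ℕ, δ ≤ ∏ t ∈ Finset.range N, (1 - Q ^ (t + 1)) := by
  refine ⟨Real.exp (-(1 / (1 - Q) * (1 - Q)⁻¹)), Real.exp_pos _, fun N => ?_⟩
  have h1 : ∀ t ∈ Finset.range N, Real.exp (-(1 / (1 - Q) * Q ^ t)) ≤ 1 - Q ^ (t + 1) := by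
    intro t _
    have hq : Q ^ (t + 1) ≤ Q := by
      calc Q ^ (t + 1) ≤ Q ^ 1 := pow_le_pow_of_le_one hQ0.le hQ1.le (by omega)
        _ = Q := pow_one Q
    have hq' : Q ^ (t + 1) ≤ Q ^ t := pow_le_pow_of_le_one hQ0.le hQ1.le (by omega)
    have hp : 0 < Q ^ (t + 1) := by positivity
    have hpos : 0 < 1 - Q ^ (t + 1) := by linarith
    rw [Real.exp_neg]
    apply inv_le_of_inv_le₀ hpos
    have h2 : (1 - Q ^ (t + 1))⁻¹ = Q ^ (t + 1) / (1 - Q ^ (t + 1)) + 1 := by field_simp; ring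
    rw [h2]
    refine (Real.add_one_le_exp _).trans (Real.exp_le_exp.2 ?_)
    rw [div_mul_eq_mul_div, one_mul]
    exact div_le_div₀ (by positivity) hq' (by linarith) (by linarith)
  refine le_trans ?_ (Finset.prod_le_prod (fun t _ => (Real.exp_pos _).le) h1)
  rw [← Real.exp_sum]
  apply Real.exp_le_exp.2
  rw [Finset.sum_neg_distrib, neg_le_neg_iff, ← Finset.mul_sum]
  have : 0 < 1 - Q := by linarith
  refine mul_le_mul_of_nonneg_left ?_ (by positivity)
  rw [← tsum_geometric_of_lt_one hQ0.le hQ1]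
  exact (summable_geometric_of_lt_one hQ0.le hQ1).sum_le_tsum _ fun i _ => by positivity

/-- polynomial used for testing -/
noncomputable def testP (Q y : ℝ) (k d : ℕ) : ℝ[X] :=
  (X + C y) * ((∏ i ∈ Finset.range k, (X ^ 2 - C (Q ^ i))) *
    ∏ t ∈ Finset.range d, (X ^ 2 - C (Q ^ (k + 1 + t))))

lemma testP_deg (Q y : ℝ) (k d : ℕ) : (testP Q y k d).degree < ((2 * (k + 1 + d) : ℕ) : WithBot ℕ) := by
  have h : (testP Q y k d).natDegree ≤ 1 + (k * 2 + d * 2) := by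
    unfold testP
    refine natDegree_mul_le.trans (add_le_add (natDegree_X_add_C y).le ?_)
    refine natDegree_mul_le.trans (add_le_add ?_ ?_)
    · refine (natDegree_prod_le _ _).trans ?_
      simp only [natDegree_X_pow_sub_C, Finset.sum_const, Finset.card_range, smul_eq_mul, le_refl]
    · refine (natDegree_prod_le _ _).trans ?_
      simp only [natDegree_X_pow_sub_C, Finset.sum_const, Finset.card_range, smul_eq_mul, le_refl]
  refine lt_of_le_of_lt degree_le_natDegree ?_
  exact_mod_cast (by omega : (testP Q y k d).natDegree < 2 * (k + 1 + d))

lemma testP_eval (Q y : ℝ) (k d : ℕ) (x : ℝ) : (testP Q y k d).eval x =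
    (x + y) * ((∏ i ∈ Finset.range k, (x ^ 2 - Q ^ i)) *
    ∏ t ∈ Finset.range d, (x ^ 2 - Q ^ (k + 1 + t))) := by
  simp [testP, eval_prod]

lemma testP_bound {Q δ : ℝ} (hQ0 : 0 < Q) (hQ1 : Q < 1) (hδ0 : 0 < δ)
    (hδ : ∀ N : ℕ, δ ≤ ∏ t ∈ Finset.range N, (1 - Q ^ (t + 1))) (k d j : ℕ) (hj : k + 1 + d ≤ j) :
    |((∏ i ∈ Finset.range k, (Q ^ j - Q ^ i)) *
      ∏ t ∈ Finset.range d, (Q ^ j - Q ^ (k + 1 + t)))| * δ ^ 2 ≤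
    Q ^ d * |((∏ i ∈ Finset.range k, (Q ^ k - Q ^ i)) *
      ∏ t ∈ Finset.range d, (Q ^ k - Q ^ (k + 1 + t)))| := by
  have mono : ∀ {a b : ℕ}, a ≤ b → Q ^ b ≤ Q ^ a := fun h => pow_le_pow_of_le_one hQ0.le hQ1.le h
  have hp : ∀ a : ℕ, 0 < Q ^ a := fun a => by positivity
  have le1 : ∀ a : ℕ, Q ^ a ≤ 1 := fun a => pow_le_one₀ hQ0.le hQ1.le
  have b1 : |∏ i ∈ Finset.range k, (Q ^ j - Q ^ i)| * δ ≤ |∏ i ∈ Finset.range k, (Q ^ k - Q ^ i)| := by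
    have hr : ∏ t ∈ Finset.range k, (1 - Q ^ (t + 1)) = ∏ i ∈ Finset.range k, (1 - Q ^ (k - i)) := by
      rw [← Finset.prod_range_reflect]
      refine Finset.prod_congr rfl fun i hi => ?_
      have := Finset.mem_range.1 hi
      congr 2; omega
    calc _ ≤ |∏ i ∈ Finset.range k, (Q ^ j - Q ^ i)| * ∏ i ∈ Finset.range k, (1 - Q ^ (k - i)) := by
          rw [← hr]; exact mul_le_mul_of_nonneg_left (hδ k) (abs_nonneg _)
      _ ≤ _ := by
          rw [Finset.abs_prod, Finset.abs_prod, ← Finset.prod_mul_distrib]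
          refine Finset.prod_le_prod (fun i _ => mul_nonneg (abs_nonneg _) (by linarith [le1 (k - i)])) ?_
          intro i hi
          have hi := Finset.mem_range.1 hi
          have e : Q ^ k = Q ^ i * Q ^ (k - i) := by rw [← pow_add]; congr 1; omega
          have m1 : Q ^ j ≤ Q ^ i := mono (by omega)
          have m2 : Q ^ k ≤ Q ^ i := mono (by omega)
          rw [abs_of_nonpos (by linarith), abs_of_nonpos (by linarith)]
          have := le1 (k - i)
          rw [e]
          nlinarith [hp j]
  have b2 : |∏ t ∈ Finset.range d, (Q ^ j - Q ^ (k + 1 + t))| * δ ≤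
      Q ^ d * |∏ t ∈ Finset.range d, (Q ^ k - Q ^ (k + 1 + t))| := by
    calc _ ≤ |∏ t ∈ Finset.range d, (Q ^ j - Q ^ (k + 1 + t))| * ∏ t ∈ Finset.range d, (1 - Q ^ (t + 1)) :=
          mul_le_mul_of_nonneg_left (hδ d) (abs_nonneg _)
      _ ≤ _ := by
          have : Q ^ d = ∏ t ∈ Finset.range d, Q := by simp
          rw [this, Finset.abs_prod, Finset.abs_prod, ← Finset.prod_mul_distrib, ← Finset.prod_mul_distrib]
          refine Finset.prod_le_prod (fun i _ => mul_nonneg (abs_nonneg _) (by linarith [le1 (i + 1)])) ?_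
          intro t ht
          have ht := Finset.mem_range.1 ht
          have e : Q ^ (k + 1 + t) = Q ^ k * Q ^ (t + 1) := by rw [← pow_add]; congr 1; omega
          have e2 : Q ^ (t + 1) ≤ Q ^ 1 := mono (by omega)
          have m1 : Q ^ j ≤ Q ^ (k + 1 + t) := mono (by omega)
          have m2 : Q ^ (k + 1 + t) ≤ Q ^ k := mono (by omega)
          rw [abs_of_nonpos (by linarith), abs_of_nonneg (by linarith)]
          have l1 := le1 (t + 1)
          rw [e]
          have h1 : -(Q ^ j - Q ^ k * Q ^ (t + 1)) ≤ Q ^ k * Q := by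
            have := mul_le_mul_of_nonneg_left e2 (hp k).le
            rw [pow_one] at this
            linarith [hp j]
          calc _ ≤ (Q ^ k * Q) * (1 - Q ^ (t + 1)) := mul_le_mul_of_nonneg_right h1 (by linarith)
            _ = _ := by ring
  rw [abs_mul, abs_mul]
  calc _ = (|∏ i ∈ Finset.range k, (Q ^ j - Q ^ i)| * δ) *
        (|∏ t ∈ Finset.range d, (Q ^ j - Q ^ (k + 1 + t))| * δ) := by ring
    _ ≤ _ := mul_le_mul b1 b2 (by positivity) (abs_nonneg _)
    _ = _ := by ring

lemma tail_mass {A : ℝ} (hA0 : 0 < A) (hA1 : A < 1) (m : ℕ) :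
    NN (ms A) (fun i : ℕ × Bool => if m ≤ i.1 then 1 else 0) = 2 / (1 - A) * A ^ m := by
  unfold NN ms
  have hs : Summable (fun k : ℕ => (if m ≤ k then A ^ k else 0)) := by
    refine Summable.of_nonneg_of_le (fun k => by positivity) (fun k => ?_)
      (summable_geometric_of_lt_one hA0.le hA1)
    split_ifs
    · exact le_rfl
    · positivity
  have e : ∀ i : ℕ × Bool, ‖(if m ≤ i.1 then (1 : ℂ) else 0)‖ ^ 2 * A ^ i.1 =
      (fun k : ℕ => (if m ≤ k then A ^ k else 0)) i.1 := by
    intro i; beta_reduce; split_ifs <;> simp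
  simp_rw [e]
  rw [tsum_bool' (summ_bool hs)]
  have e2 : ∀ k : ℕ, ((if m ≤ k then A ^ k else 0) + (if m ≤ k then A ^ k else 0)) =
    2 * (if m ≤ k then A ^ k else 0) := fun k => by ring
  simp_rw [e2]
  rw [tsum_mul_left, ← hs.sum_add_tsum_nat_add m]
  have z : ∑ k ∈ Finset.range m, (if m ≤ k then A ^ k else 0) = 0 := by
    refine Finset.sum_eq_zero fun k hk => ?_
    have := Finset.mem_range.1 hk
    rw [if_neg (by omega)]
  rw [z, zero_add]
  have e3 : ∀ k, (if m ≤ k + m then A ^ (k + m) else 0) = A ^ m * A ^ k := fun k => by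
    rw [if_pos (by omega)]; ring
  simp_rw [e3]
  rw [tsum_mul_left, tsum_geometric_of_lt_one hA0.le hA1]
  field_simp

/-- value at a large node -/
lemma node_bound {q A δ : ℝ} (hq0 : 0 < q) (hq1 : q < 1) (hA0 : 0 < A) (hA1 : A < 1) (hδ0 : 0 < δ)
    (hδ : ∀ N : ℕ, δ ≤ ∏ t ∈ Finset.range N, (1 - (q ^ 2) ^ (t + 1))) (k d : ℕ) (b : Bool)
    (f : ℕ × Bool → ℂ) (hf : Bd f)
    (horth : ∀ j < 2 * (k + 1 + d), EE (ms A) (fun i => f i * (nd q i : ℂ) ^ j) = 0) :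
    ‖f (k, b)‖ ^ 2 * A ^ k ≤ (δ ^ 4)⁻¹ * (2 / (1 - A)) * (q ^ 2) ^ (2 * d) * NN (ms A) f := by
  have hQ0 : 0 < q ^ 2 := by positivity
  have hQ1 : q ^ 2 < 1 := pow_lt_one₀ hq0.le hq1 (by norm_num)
  have h0 : ∀ i, 0 ≤ ms A i := fun i => by unfold ms; positivity
  have hμ := ms_summable hA0 hA1
  set x : ℕ × Bool → ℂ := fun i => (nd q i : ℂ) with hx
  have bx : Bd x := ⟨1, fun i => by
    simp only [hx, Complex.norm_real, Real.norm_eq_abs, nd_abs hq0]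
    exact pow_le_one₀ hq0.le hq1.le⟩
  set y := nd q (k, b) with hy
  set L : ℝ[X] := testP (q ^ 2) y k d with hL
  set LC : ℂ[X] := L.map (algebraMap ℝ ℂ) with hLC
  have hLe : ∀ i, LC.eval (x i) = ((L.eval (nd q i) : ℝ) : ℂ) := by
    intro i
    exact Polynomial.eval_map_algebraMap L (nd q i : ℂ) |>.trans
      (Polynomial.aeval_algebraMap_apply_eq_algebraMap_eval (nd q i) L)
  have hLdeg : LC.degree < ((2 * (k + 1 + d) : ℕ) : WithBot ℕ) := by
    refine lt_of_le_of_lt degree_map_le (testP_deg _ _ _ _)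
  have hE := orth_poly h0 hμ hf bx horth LC hLdeg
  have bfL : Bd (fun i => f i * LC.eval (x i)) := hf.mul (bx.poly LC)
  unfold EE at hE
  rw [(bfL.summ h0 hμ).tsum_eq_add_tsum_ite (k, b)] at hE
  set T := |((∏ i ∈ Finset.range k, ((q ^ 2) ^ k - (q ^ 2) ^ i)) *
      ∏ t ∈ Finset.range d, ((q ^ 2) ^ k - (q ^ 2) ^ (k + 1 + t)))| with hT
  have Tpos : 0 < T := by
    rw [hT, abs_pos]
    refine mul_ne_zero ?_ ?_
    · refine Finset.prod_ne_zero_iff.2 fun i hi => ?_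
      have := pow_lt_pow_right_of_lt_one₀ hQ0 hQ1 (Finset.mem_range.1 hi)
      linarith
    · refine Finset.prod_ne_zero_iff.2 fun t _ => ?_
      have := pow_lt_pow_right_of_lt_one₀ hQ0 hQ1 (show k < k + 1 + t by omega)
      linarith
  have hLk : |L.eval y| = 2 * q ^ k * T := by
    rw [hL, testP_eval, hy, nd_sq, abs_mul, ← hT, ← two_mul, abs_mul, nd_abs hq0]
    simp
  set K' := 2 * q ^ k * ((δ ^ 2)⁻¹ * (q ^ 2) ^ d * T) with hK'
  have K'0 : 0 ≤ K' := by positivity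
  have bone : Bd (fun i : ℕ × Bool => if k + 1 + d ≤ i.1 then (1 : ℂ) else 0) :=
    ⟨1, fun i => by beta_reduce; split_ifs <;> simp⟩
  have hcs := EE_cs h0 hμ (h := fun i => if i = (k, b) then 0 else f i * LC.eval (x i))
    hf bone K'0 (by
      intro i
      split_ifs with h1 h2 h2
      · simp; positivity
      · simp
      · rw [norm_mul, hLe, Complex.norm_real, norm_one, mul_one, mul_comm]
        refine mul_le_mul_of_nonneg_right ?_ (norm_nonneg _)
        rw [Real.norm_eq_abs, hL, testP_eval, nd_sq, abs_mul]
        have hb := testP_bound hQ0 hQ1 hδ0 hδ k d i.1 h2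
        refine mul_le_mul ?_ ?_ (abs_nonneg _) (by positivity)
        · refine (abs_add_le _ _).trans ?_
          rw [hy, nd_abs hq0, nd_abs hq0]
          have : q ^ i.1 ≤ q ^ k := pow_le_pow_of_le_one hq0.le hq1.le (by omega)
          simp only
          linarith
        · rw [← hT] at hb
          rw [mul_assoc, ← div_eq_inv_mul, le_div_iff₀ (by positivity)]
          exact hb
      · have hz : L.eval (nd q i) = 0 := by
          rw [hL, testP_eval, nd_sq]
          rcases lt_trichotomy i.1 k with h | h | h
          · rw [Finset.prod_eq_zero (Finset.mem_range.2 h) (by ring)]; ring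
          · have : nd q i = - y := by
              have hb : i.2 = !b := by
                have : i.2 ≠ b := fun hh => h1 (Prod.ext h hh)
                cases hi : i.2 <;> cases b <;> simp_all
              rw [hy]
              unfold nd
              rw [hb, h]
              cases b <;> simp
            rw [this]; ring
          · obtain ⟨t, ht⟩ : ∃ t, i.1 = k + 1 + t := ⟨i.1 - (k + 1), by omega⟩
            rw [Finset.prod_eq_zero (i := t) (s := Finset.range d) (Finset.mem_range.2 (by omega))
              (by rw [ht]; ring)]
            ring
        rw [hLe, hz]; simp)
  rw [tail_mass hA0 hA1] at hcs
  have hE2 : f (k, b) * LC.eval (x (k, b)) * (ms A (k, b) : ℂ) =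
      - EE (ms A) (fun i => if i = (k, b) then 0 else f i * LC.eval (x i)) := by
    rw [eq_neg_iff_add_eq_zero]
    refine Eq.trans ?_ hE
    congr 1
    unfold EE
    refine tsum_congr fun i => ?_
    by_cases hi : i = (k, b)
    · simp [hi]
    · simp [hi]
  have hn := congrArg norm hE2
  rw [norm_neg, norm_mul, norm_mul, hLe, Complex.norm_real, Complex.norm_real, Real.norm_eq_abs,
    Real.norm_eq_abs, ← hy, hLk, abs_of_nonneg (h0 _)] at hn
  rw [← hn] at hcs
  have hmsk : ms A (k, b) = A ^ k := rfl
  rw [hmsk] at hcs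
  have N0 := NN_nonneg h0 f
  have hA' : 0 < 1 - A := by linarith
  have hc2 : ‖f (k, b)‖ * A ^ k ≤ (δ ^ 2)⁻¹ * (q ^ 2) ^ d *
      (√(NN (ms A) f) * √(2 / (1 - A) * A ^ (k + 1 + d))) := by
    have hp : 0 < 2 * q ^ k * T := by positivity
    refine le_of_mul_le_mul_left ?_ hp
    calc _ = ‖f (k, b)‖ * (2 * q ^ k * T) * A ^ k := by ring
      _ ≤ _ := hcs
      _ = _ := by rw [hK']; ring
  have hsq := pow_le_pow_left₀ (by positivity) hc2 2
  rw [mul_pow _ (√_ * _), mul_pow √_, Real.sq_sqrt N0, Real.sq_sqrt (by positivity)] at hsq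
  have hAk : 0 < A ^ k := by positivity
  refine le_of_mul_le_mul_right ?_ hAk
  calc ‖f (k, b)‖ ^ 2 * A ^ k * A ^ k = (‖f (k, b)‖ * A ^ k) ^ 2 := by ring
    _ ≤ _ := hsq
    _ = ((δ ^ 4)⁻¹ * (2 / (1 - A)) * (q ^ 2) ^ (2 * d) * NN (ms A) f) * A ^ (k + 1 + d) := by
      field_simp
      ring
    _ ≤ _ := by
      refine mul_le_mul_of_nonneg_left (pow_le_pow_of_le_one hA0.le hA1.le (by omega)) ?_
      positivity

lemma lemmaM {q A : ℝ} (hq0 : 0 < q) (hq1 : q < 1) (hA0 : 0 < A) (hA1 : A < 1) :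
    ∃ C : ℝ, 0 < C ∧ ∀ n : ℕ, ∀ f : ℕ × Bool → ℂ, Bd f →
      (∀ j < n, EE (ms A) (fun i => f i * (nd q i : ℂ) ^ j) = 0) →
      NN (ms A) (fun i => nd q i * f i) ≤ (C * q ^ n) * NN (ms A) f := by
  have hQ0 : 0 < q ^ 2 := by positivity
  have hQ1 : q ^ 2 < 1 := pow_lt_one₀ hq0.le hq1 (by norm_num)
  have h0 : ∀ i, 0 ≤ ms A i := fun i => by unfold ms; positivity
  have hμ := ms_summable hA0 hA1
  obtain ⟨δ, hδ0, hδ⟩ := prod_lower hQ0 hQ1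
  have hA' : 0 < 1 - A := by linarith
  have hQ' : 0 < 1 - q ^ 2 := by linarith
  set M := (δ ^ 4)⁻¹ * (2 / (1 - A)) with hM
  have hM0 : 0 < M := by positivity
  refine ⟨(1 + M * (q ^ 2)⁻¹ * (2 * (1 - q ^ 2)⁻¹)) * q⁻¹, by positivity, ?_⟩
  intro n f hf horth
  set m := n / 2 with hm
  have N0 := NN_nonneg h0 f
  set a := NN (ms A) f with ha
  set g : ℕ → ℝ := fun k => if k < m then (q ^ 2) ^ (m - 1 - k) else 0 with hg
  have hgs : Summable g := by
    refine summable_of_ne_finset_zero (s := Finset.range m) fun k hk => ?_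
    simp only [Finset.mem_range] at hk
    simp [hg, hk]
  have hgt : ∑' i : ℕ × Bool, g i.1 ≤ 2 * (1 - q ^ 2)⁻¹ := by
    rw [tsum_bool' (summ_bool hgs)]
    simp_rw [← two_mul]
    rw [tsum_mul_left]
    refine mul_le_mul_of_nonneg_left ?_ (by norm_num)
    rw [tsum_eq_sum (s := Finset.range m) (fun k hk => by
      simp only [Finset.mem_range] at hk
      simp [hg, hk])]
    have : ∑ k ∈ Finset.range m, g k = ∑ k ∈ Finset.range m, (q ^ 2) ^ k := by
      rw [← Finset.sum_range_reflect]
      refine Finset.sum_congr rfl fun k hk => ?_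
      have := Finset.mem_range.1 hk
      simp only [hg]
      rw [if_pos (by omega)]
      congr 1; omega
    rw [this, ← tsum_geometric_of_lt_one hQ0.le hQ1]
    exact (summable_geometric_of_lt_one hQ0.le hQ1).sum_le_tsum _ fun i _ => by positivity
  have pt : ∀ i : ℕ × Bool, ‖(nd q i : ℂ) * f i‖ ^ 2 * ms A i ≤
      (q ^ 2) ^ m * (‖f i‖ ^ 2 * ms A i) + (M * (q ^ 2)⁻¹ * (q ^ 2) ^ m * a) * g i.1 := by
    rintro ⟨k, b⟩
    have e : ‖(nd q (k, b) : ℂ) * f (k, b)‖ ^ 2 = (q ^ 2) ^ k * ‖f (k, b)‖ ^ 2 := by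
      rw [norm_mul, mul_pow, Complex.norm_real, Real.norm_eq_abs, sq_abs, nd_sq]
    rw [e]
    have hmsn : 0 ≤ ‖f (k, b)‖ ^ 2 * ms A (k, b) := mul_nonneg (by positivity) (h0 _)
    by_cases hk : k < m
    · obtain ⟨d, hd⟩ : ∃ d, m = k + 1 + d := ⟨m - (k + 1), by omega⟩
      have nb := node_bound hq0 hq1 hA0 hA1 hδ0 hδ k d b f hf (fun j hj => horth j (by omega))
      have hgk : g k = (q ^ 2) ^ d := by
        simp only [hg]; rw [if_pos hk]; congr 1; omega
      have : (q ^ 2) ^ k * ‖f (k, b)‖ ^ 2 * ms A (k, b) ≤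
          (M * (q ^ 2)⁻¹ * (q ^ 2) ^ m * a) * g k := by
        calc _ = (q ^ 2) ^ k * (‖f (k, b)‖ ^ 2 * A ^ k) := by unfold ms; ring
          _ ≤ (q ^ 2) ^ k * (M * (q ^ 2) ^ (2 * d) * a) := mul_le_mul_of_nonneg_left nb (by positivity)
          _ = _ := by
            rw [hgk, hd]
            field_simp
            ring
      simp only
      have : 0 ≤ (q ^ 2) ^ m * (‖f (k, b)‖ ^ 2 * ms A (k, b)) := by positivity
      linarith
    · have h1 : (q ^ 2) ^ k ≤ (q ^ 2) ^ m := pow_le_pow_of_le_one hQ0.le hQ1.le (by omega)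
      have hgk : g k = 0 := by simp only [hg]; rw [if_neg hk]
      simp only [hgk]
      nlinarith
  have bx : Bd (fun i => (nd q i : ℂ)) := ⟨1, fun i => by
    simp only [Complex.norm_real, Real.norm_eq_abs, nd_abs hq0]
    exact pow_le_one₀ hq0.le hq1.le⟩
  have s1 := (bx.mul hf).summN h0 hμ
  have s2 := (hf.summN h0 hμ).mul_left ((q ^ 2) ^ m)
  have s3 := (summ_bool hgs).mul_left (M * (q ^ 2)⁻¹ * (q ^ 2) ^ m * a)
  have ht := s1.tsum_le_tsum pt (s2.add s3)
  rw [s2.tsum_add s3, tsum_mul_left, tsum_mul_left] at ht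
  have hqn : (q ^ 2) ^ m ≤ q⁻¹ * q ^ n := by
    rw [← div_eq_inv_mul, le_div_iff₀ hq0, ← pow_mul, ← pow_succ]
    exact pow_le_pow_of_le_one hq0.le hq1.le (by omega)
  calc _ ≤ (q ^ 2) ^ m * a + M * (q ^ 2)⁻¹ * (q ^ 2) ^ m * a * ∑' i : ℕ × Bool, g i.1 := ht
    _ ≤ (q ^ 2) ^ m * a + M * (q ^ 2)⁻¹ * (q ^ 2) ^ m * a * (2 * (1 - q ^ 2)⁻¹) := by gcongr
    _ = (1 + M * (q ^ 2)⁻¹ * (2 * (1 - q ^ 2)⁻¹)) * a * (q ^ 2) ^ m := by ring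
    _ ≤ (1 + M * (q ^ 2)⁻¹ * (2 * (1 - q ^ 2)⁻¹)) * a * (q⁻¹ * q ^ n) := by gcongr
    _ = _ := by ring

lemma moment_even {q A : ℝ} (hq0 : 0 < q) (hq1 : q < 1) (hA0 : 0 < A) (hA1 : A < 1) (l : ℕ) :
    EE (ms A) (fun i => (nd q i : ℂ) ^ (2 * l)) = ((2 / (1 - A * (q ^ 2) ^ l) : ℝ) : ℂ) := by
  have hQ0 : 0 < q ^ 2 := by positivity
  have hQ1 : q ^ 2 < 1 := pow_lt_one₀ hq0.le hq1 (by norm_num)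
  have hlt := one_sub_pos' hA0 hA1 hQ0 hQ1 l
  have hs : Summable (fun k : ℕ => (A * (q ^ 2) ^ l) ^ k) :=
    summable_geometric_of_lt_one (by positivity) (by linarith)
  have e : ∀ i : ℕ × Bool, (nd q i : ℂ) ^ (2 * l) * (ms A i : ℂ) =
      ((((A * (q ^ 2) ^ l) ^ i.1 : ℝ)) : ℂ) := by
    intro i
    rw [pow_mul]
    have := nd_sq q i
    norm_cast
    rw [this]
    unfold ms
    ring
  unfold EE
  simp_rw [e]
  rw [← Complex.ofReal_tsum, tsum_bool' (summ_bool hs)]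
  congr 1
  simp_rw [← two_mul]
  rw [tsum_mul_left, tsum_geometric_of_lt_one (by positivity) (by linarith)]
  rfl

lemma nd_bd {q : ℝ} (hq0 : 0 < q) (hq1 : q < 1) : Bd (fun i => (nd q i : ℂ)) := ⟨1, fun i => by
    simp only [Complex.norm_real, Real.norm_eq_abs, nd_abs hq0]
    exact pow_le_one₀ hq0.le hq1.le⟩

lemma moment_odd {q A : ℝ} (hq0 : 0 < q) (hq1 : q < 1) (hA0 : 0 < A) (hA1 : A < 1) (j : ℕ)
    (hj : Odd j) : EE (ms A) (fun i => (nd q i : ℂ) ^ j) = 0 := by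
  have h0 : ∀ i, 0 ≤ ms A i := fun i => by unfold ms; positivity
  have hμ := ms_summable hA0 hA1
  unfold EE
  rw [tsum_bool' (((nd_bd hq0 hq1).pow j).summ h0 hμ)]
  rw [← tsum_zero]
  refine tsum_congr fun k => ?_
  simp [nd, ms, hj.neg_pow]

lemma base_poly {q A : ℝ} (hq0 : 0 < q) (hq1 : q < 1) (hA0 : 0 < A) (hA1 : A < 1) (m e : ℕ)
    (he : e ≤ 1) : ∃ P0 : ℝ[X], P0.Monic ∧ P0.natDegree = 2 * m + e ∧
      (∀ j < 2 * m + e, EE (ms A) (fun i => ((P0.eval (nd q i) : ℝ) : ℂ) * (nd q i : ℂ) ^ j) = 0) ∧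
      EE (ms A) (fun i => ((P0.eval (nd q i) : ℝ) : ℂ) * (P0.eval (nd q i) : ℝ)) =
        ((2 * baseG (A * (q ^ 2) ^ e) (q ^ 2) m : ℝ) : ℂ) := by
  have hQ0 : 0 < q ^ 2 := by positivity
  have hQ1 : q ^ 2 < 1 := pow_lt_one₀ hq0.le hq1 (by norm_num)
  have h0 : ∀ i, 0 ≤ ms A i := fun i => by unfold ms; positivity
  have hμ := ms_summable hA0 hA1
  have bx := nd_bd hq0 hq1
  obtain ⟨c, hcm, hc1, hc2⟩ := cauchyCoef (A := A * (q ^ 2) ^ e) (Q := q ^ 2) (by positivity)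
    (by linarith [one_sub_pos' hA0 hA1 hQ0 hQ1 e]) hQ0 hQ1 m
  set R : ℝ[X] := ∑ j ∈ Finset.range m, C (c j) * X ^ (2 * j + e) with hR
  set P0 : ℝ[X] := X ^ (2 * m + e) + R with hP0
  have hRd : R.degree < ((2 * m + e : ℕ) : WithBot ℕ) := by
    refine (degree_sum_le _ _).trans_lt ?_
    rw [Finset.sup_lt_iff (WithBot.bot_lt_coe _)]
    intro j hj
    have := Finset.mem_range.1 hj
    refine (degree_C_mul_X_pow_le _ _).trans_lt ?_
    exact_mod_cast (by omega : 2 * j + e < 2 * m + e)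
  have hmon : P0.Monic := monic_X_pow_add hRd
  have hdeg : P0.natDegree = 2 * m + e := by
    rw [hP0]
    apply natDegree_eq_of_degree_eq_some
    rw [degree_add_eq_left_of_degree_lt (by rwa [degree_X_pow]), degree_X_pow]
  have hev : ∀ x : ℝ, P0.eval x = ∑ j ∈ Finset.range (m + 1), c j * x ^ (2 * j + e) := by
    intro x
    rw [Finset.sum_range_succ, hcm, hP0, hR]
    simp [eval_finsetSum]
    ring
  have bP0 : Bd (fun i => ((P0.eval (nd q i) : ℝ) : ℂ)) := by
    have := bx.poly (P0.map (algebraMap ℝ ℂ))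
    have e : ∀ i, (P0.map (algebraMap ℝ ℂ)).eval (nd q i : ℂ) = ((P0.eval (nd q i) : ℝ) : ℂ) :=
      fun i => Polynomial.eval_map_algebraMap P0 (nd q i : ℂ) |>.trans
        (Polynomial.aeval_algebraMap_apply_eq_algebraMap_eval (nd q i) P0)
    simpa [e] using this
  have hE : ∀ j, EE (ms A) (fun i => ((P0.eval (nd q i) : ℝ) : ℂ) * (nd q i : ℂ) ^ j) =
      ∑ t ∈ Finset.range (m + 1), (c t : ℂ) * EE (ms A) (fun i => (nd q i : ℂ) ^ (2 * t + e + j)) := by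
    intro j
    unfold EE
    simp_rw [← tsum_mul_left]
    rw [← Summable.tsum_finsetSum]
    · refine tsum_congr fun i => ?_
      rw [hev]
      push_cast
      rw [Finset.sum_mul, Finset.sum_mul]
      exact Finset.sum_congr rfl fun t _ => by ring
    · intro t _
      exact ((bx.pow _).summ h0 hμ).mul_left _
  have hE2 : ∀ l, EE (ms A) (fun i => ((P0.eval (nd q i) : ℝ) : ℂ) * (nd q i : ℂ) ^ (2 * l + e)) =
      ((2 * ∑ t ∈ Finset.range (m + 1), c t / (1 - A * (q ^ 2) ^ e * (q ^ 2) ^ (t + l)) : ℝ) : ℂ) := by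
    intro l
    rw [hE, Finset.mul_sum]
    push_cast
    refine Finset.sum_congr rfl fun t _ => ?_
    have e1 : 2 * t + e + (2 * l + e) = 2 * (t + l + e) := by ring
    rw [e1, moment_even hq0 hq1 hA0 hA1]
    push_cast
    have : (A : ℂ) * ((q : ℂ) ^ 2) ^ (t + l + e) = A * (q ^ 2) ^ e * (q ^ 2) ^ (t + l) := by ring
    rw [this]
    ring
  have horth : ∀ j < 2 * m + e,
      EE (ms A) (fun i => ((P0.eval (nd q i) : ℝ) : ℂ) * (nd q i : ℂ) ^ j) = 0 := by
    intro j hj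
    rcases Nat.even_or_odd (e + j) with h | h
    · obtain ⟨l, hl⟩ : ∃ l, j = 2 * l + e := by
        obtain ⟨s, hs⟩ := h
        exact ⟨s - e, by omega⟩
      rw [hl, hE2, hc1 l (by omega)]
      simp
    · rw [hE]
      refine Finset.sum_eq_zero fun t _ => ?_
      rw [moment_odd hq0 hq1 hA0 hA1, mul_zero]
      rw [add_assoc]
      exact (even_two_mul t).add_odd h
  refine ⟨P0, hmon, hdeg, horth, ?_⟩
  have e1 : (fun i => ((P0.eval (nd q i) : ℝ) : ℂ) * (P0.eval (nd q i) : ℝ)) =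
      fun i => ((P0.eval (nd q i) : ℝ) : ℂ) * (nd q i : ℂ) ^ (2 * m + e) +
        ((P0.eval (nd q i) : ℝ) : ℂ) * (R.map (algebraMap ℝ ℂ)).eval (nd q i : ℂ) := by
    funext i
    have e : (R.map (algebraMap ℝ ℂ)).eval (nd q i : ℂ) = ((R.eval (nd q i) : ℝ) : ℂ) :=
      Polynomial.eval_map_algebraMap R (nd q i : ℂ) |>.trans
        (Polynomial.aeval_algebraMap_apply_eq_algebraMap_eval (nd q i) R)
    rw [e, ← mul_add]
    congr 1
    rw [hP0]
    simp
  rw [e1, EE_add h0 hμ (bP0.mul (bx.pow _)) (bP0.mul (bx.poly _)),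
    orth_poly h0 hμ bP0 bx horth _ (degree_map_le.trans_lt hRd), add_zero, hE2, hc2]

lemma final_est {ρ e1 e2 : ℂ} {s : ℝ} (hρ : ‖ρ - 1‖ ≤ s) (h1 : ‖e1‖ ≤ s) (h2 : ‖e2‖ ≤ s)
    (hs : s ≤ 1 / 2) : ‖ρ * (1 + e1) / (1 + e2) - 1‖ ≤ 7 * s := by
  have hb : 1 / 2 ≤ ‖1 + e2‖ := by
    have := norm_sub_norm_le (1 : ℂ) (-e2)
    simp at this
    linarith
  have hne : 1 + e2 ≠ 0 := by
    intro h; rw [h] at hb; norm_num at hb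
  have e : ρ * (1 + e1) / (1 + e2) - 1 = ((ρ - 1) * (1 + e1) + e1 - e2) / (1 + e2) := by
    field_simp; ring
  have h3 : ‖1 + e1‖ ≤ 3 / 2 := by
    have := norm_add_le (1 : ℂ) e1
    simp at this
    linarith
  have s0 : 0 ≤ s := (norm_nonneg _).trans h1
  rw [e, norm_div, div_le_iff₀ (by linarith)]
  calc _ ≤ ‖ρ - 1‖ * ‖1 + e1‖ + ‖e1‖ + ‖e2‖ := by
        rw [← norm_mul]
        exact (norm_sub_le _ _).trans (add_le_add (norm_add_le _ _) le_rfl)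
    _ ≤ s * (3 / 2) + s + s := by gcongr
    _ ≤ _ := by nlinarith

lemma rho_est {A Q : ℝ} (hA0 : 0 < A) (hA1 : A < 1) (hQ0 : 0 < Q) (hQ1 : Q < 1) (m : ℕ) :
    |(1 - Q ^ (m + 1)) ^ 2 / ((1 - A * Q ^ (2 * m + 1)) * (1 - A * Q ^ (2 * m + 2))) - 1| ≤
      2 * Q ^ (m + 1) := by
  have t0 : 0 < Q ^ (m + 1) := by positivity
  have t1 : Q ^ (m + 1) < 1 := pow_lt_one₀ hQ0.le hQ1 (by omega)
  have pa := one_sub_pos' hA0 hA1 hQ0 hQ1 (2 * m + 1)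
  have pb := one_sub_pos' hA0 hA1 hQ0 hQ1 (2 * m + 2)
  have la : A * Q ^ (2 * m + 1) ≤ Q ^ (m + 1) := by
    have : Q ^ (2 * m + 1) ≤ Q ^ (m + 1) := pow_le_pow_of_le_one hQ0.le hQ1.le (by omega)
    have : 0 < Q ^ (2 * m + 1) := by positivity
    nlinarith
  have lb : A * Q ^ (2 * m + 2) ≤ Q ^ (m + 1) := by
    have : Q ^ (2 * m + 2) ≤ Q ^ (m + 1) := pow_le_pow_of_le_one hQ0.le hQ1.le (by omega)
    have : 0 < Q ^ (2 * m + 2) := by positivity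
    nlinarith
  have a0 : 0 < A * Q ^ (2 * m + 1) := by positivity
  have b0 : 0 < A * Q ^ (2 * m + 2) := by positivity
  generalize Q ^ (m + 1) = t at *
  generalize A * Q ^ (2 * m + 1) = a at *
  generalize A * Q ^ (2 * m + 2) = b at *
  have hab : 0 < (1 - a) * (1 - b) := mul_pos pa pb
  rw [abs_le]
  constructor
  · rw [neg_le_sub_iff_le_add, ← sub_le_iff_le_add, le_div_iff₀ hab]
    by_cases h : 0 ≤ 1 - 2 * t
    · have : (1 - a) * (1 - b) ≤ 1 := by nlinarith
      nlinarith [sq_nonneg t]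
    · nlinarith [sq_nonneg (1 - t)]
  · have : (1 - t) ^ 2 / ((1 - a) * (1 - b)) ≤ 1 := by
      rw [div_le_one hab]
      nlinarith
    linarith

lemma exists_bd {F : ℕ → ℝ} {B : ℝ} {N : ℕ} (h : ∀ k, N < k → F k ≤ B) :
    ∃ D, 0 < D ∧ ∀ k, F k ≤ D := by
  refine ⟨|B| + 1 + ∑ k ∈ Finset.range (N + 1), |F k|, by positivity, fun k => ?_⟩
  have hs : 0 ≤ ∑ k ∈ Finset.range (N + 1), |F k| := by positivity
  by_cases hk : N < k
  · have := h k hk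
    have := le_abs_self B
    linarith
  · have := Finset.single_le_sum (f := fun k => |F k|) (fun i _ => abs_nonneg _)
      (Finset.mem_range.2 (by omega : k < N + 1))
    have := le_abs_self (F k)
    have := abs_nonneg B
    linarith

lemma weight_bd {q c : ℝ} (hq0 : 0 < q) (hq1 : q < 1) (hc : 0 < c) {v : ℕ → ℂ} {N₀ : ℕ}
    (h : ∀ k, N₀ < k → ‖1 - v k‖ ≤ c * (q ^ 2) ^ k) :
    ∃ D, 0 < D ∧ ∀ k, ‖1 - (v k)⁻¹‖ ≤ D * (q ^ 2) ^ k ∧ ‖v k‖ ≤ D := by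
  have hQ0 : 0 < q ^ 2 := by positivity
  have hQ1 : q ^ 2 < 1 := pow_lt_one₀ hq0.le hq1 (by norm_num)
  obtain ⟨N, hN⟩ := exists_pow_lt_of_lt_one (show 0 < 1 / (2 * c) by positivity) hQ1
  have hs : ∀ k, max N₀ N < k → ‖1 - v k‖ ≤ 1 / 2 := by
    intro k hk
    have h1 : (q ^ 2) ^ k ≤ (q ^ 2) ^ N := pow_le_pow_of_le_one hQ0.le hQ1.le (by omega)
    refine (h k (by omega)).trans ?_
    calc c * (q ^ 2) ^ k ≤ c * (1 / (2 * c)) := by gcongr; linarith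
      _ = 1 / 2 := by field_simp
  obtain ⟨D1, hD1, hD1'⟩ := exists_bd (F := fun k => ‖v k‖) (B := 3 / 2) (N := max N₀ N) (by
    intro k hk
    have := hs k hk
    have h2 := norm_sub_norm_le (v k) 1
    rw [norm_sub_rev] at h2
    simp at h2
    linarith)
  obtain ⟨D2, hD2, hD2'⟩ := exists_bd (F := fun k => ‖1 - (v k)⁻¹‖ / (q ^ 2) ^ k) (B := 2 * c)
    (N := max N₀ N) (by
    intro k hk
    have h1 := hs k hk
    have h3 := h k (by omega)
    have h2 := norm_sub_norm_le 1 (v k)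
    simp only [norm_one] at h2
    have hv : 1 / 2 ≤ ‖v k‖ := by linarith
    have hne : v k ≠ 0 := by intro h; rw [h] at hv; norm_num at hv
    have e : 1 - (v k)⁻¹ = - (1 - v k) / v k := by field_simp; ring
    rw [div_le_iff₀ (by positivity), e, norm_div, norm_neg, div_le_iff₀ (by linarith)]
    have : 0 < c * (q ^ 2) ^ k := by positivity
    nlinarith)
  refine ⟨D1 + D2, by positivity, fun k => ⟨?_, ?_⟩⟩
  · have := hD2' k
    rw [div_le_iff₀ (by positivity)] at this
    refine this.trans ?_
    gcongr; linarith
  · have := hD1' k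
    linarith

lemma orth_mono {ι : Type*} {μ : ι → ℝ} (h0 : ∀ i, 0 ≤ μ i) (hμ : Summable μ)
    {f x : ι → ℂ} (hf : Bd f) (hx : Bd x) (P : ℕ → ℂ[X]) (hmonic : ∀ n, (P n).Monic)
    (hdeg : ∀ n, (P n).natDegree = n) (n : ℕ)
    (h : ∀ m < n, EE μ (fun i => f i * (P m).eval (x i)) = 0) :
    ∀ d ≤ n, ∀ R : ℂ[X], R.degree < (d : WithBot ℕ) → EE μ (fun i => f i * R.eval (x i)) = 0 := by
  intro d
  induction d with
  | zero =>
    intro _ R hR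
    have : R = 0 := by simpa using hR
    simp [this, EE]
  | succ d ih =>
    intro hd R hR
    set S := R - C (R.coeff d) * P d with hS
    have hSd : S.degree < (d : WithBot ℕ) := by
      rw [degree_lt_iff_coeff_zero]
      intro k hk
      rw [hS, coeff_sub, coeff_C_mul]
      rcases hk.eq_or_lt with rfl | hk
      · have := (hmonic d).coeff_natDegree
        rw [hdeg] at this
        rw [this]; ring
      · rw [(degree_lt_iff_coeff_zero R (d + 1)).1 hR k hk,
          coeff_eq_zero_of_natDegree_lt (p := P d) (by rw [hdeg]; exact hk)]
        ring
    have e : (fun i => f i * R.eval (x i)) =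
        fun i => f i * S.eval (x i) + R.coeff d * (f i * (P d).eval (x i)) := by
      funext i
      simp only [hS, eval_sub, eval_mul, eval_C]
      ring
    rw [e, EE_add h0 hμ (hf.mul (hx.poly _)) ((Bd.const _).mul (hf.mul (hx.poly _))), EE_smul,
      ih (by omega) S hSd, h d (by omega)]
    ring

/-- asymptotics of the recurrence coefficients `a_n = γ_n / γ_{n-1}`. -/
theorem statement3
    (q α : ℝ) (hq0 : 0 < q) (hq1 : q < 1) (hα : -1 < α)
    (r : ℝ) (hr1 : 1 < r) (hr2 : r < q⁻¹)
    (w : ℂ → ℂ) (hw : AnalyticOn ℂ w (Metric.ball (0 : ℂ) r))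
    (hwne : ∀ k : ℕ, w ((q : ℂ) ^ k) ≠ 0 ∧ w (-((q : ℂ) ^ k)) ≠ 0)
    (c : ℝ) (hc : 0 < c) (N₀ : ℕ)
    (hwnear : ∀ n : ℕ, n > N₀ →
      ‖1 - w (((Real.sqrt q ^ n : ℝ) : ℂ))‖ < c * q ^ n ∧
      ‖1 - w (-((Real.sqrt q ^ n : ℝ) : ℂ))‖ < c * q ^ n)
    (P : ℕ → Polynomial ℂ) (hmonic : ∀ n, (P n).Monic) (hdeg : ∀ n, (P n).natDegree = n)
    (γ : ℕ → ℂ) (hγ : ∀ n, γ n ≠ 0)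
    (horth : ∀ n m : ℕ, HasSum
      (fun k : ℕ =>
        ((P n).eval ((q : ℂ) ^ k) * (P m).eval ((q : ℂ) ^ k) * w ((q : ℂ) ^ k) +
          (P n).eval (-((q : ℂ) ^ k)) * (P m).eval (-((q : ℂ) ^ k)) * w (-((q : ℂ) ^ k))) *
        ((q ^ ((k : ℝ) * (1 + α)) : ℝ) : ℂ))
      (if n = m then γ n else 0)) :
    ∃ C : ℝ, 0 < C ∧ ∃ N : ℕ, ∀ n : ℕ, n > N → Even n →
      ‖((q ^ (-((n : ℝ) - 1 + α)) : ℝ) : ℂ) * (γ n / γ (n - 1)) - 1‖ ≤ C * q ^ n := by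
  have hQ0 : 0 < q ^ 2 := by positivity
  have hQ1 : q ^ 2 < 1 := pow_lt_one₀ hq0.le hq1 (by norm_num)
  set A : ℝ := q ^ (1 + α) with hA
  have hA0 : 0 < A := Real.rpow_pos_of_pos hq0 _
  have hA1 : A < 1 := Real.rpow_lt_one hq0.le hq1 (by linarith)
  have h0 : ∀ i, 0 ≤ ms A i := fun i => by unfold ms; positivity
  have hμ := ms_summable hA0 hA1
  have bx := nd_bd hq0 hq1
  have hnt : ∀ k, (nd q (k, true) : ℂ) = (q : ℂ) ^ k := fun k => by simp [nd]
  have hnf : ∀ k, (nd q (k, false) : ℂ) = -(q : ℂ) ^ k := fun k => by simp [nd]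
  set u : ℕ × Bool → ℂ := fun i => w (nd q i) with hu
  have hAk : ∀ k : ℕ, (q ^ ((k : ℝ) * (1 + α)) : ℝ) = A ^ k := by
    intro k
    rw [mul_comm, Real.rpow_mul hq0.le, Real.rpow_natCast]
  have hune : ∀ i, u i ≠ 0 := by
    rintro ⟨k, b⟩
    simp only [hu]
    cases b
    · rw [hnf]; exact (hwne k).2
    · rw [hnt]; exact (hwne k).1
  have hsq : ∀ k : ℕ, ((Real.sqrt q ^ (2 * k) : ℝ) : ℂ) = (q : ℂ) ^ k := by
    intro k
    rw [pow_mul, Real.sq_sqrt hq0.le]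
    push_cast; rfl
  obtain ⟨D1, hD1, hD1'⟩ := weight_bd (v := fun k => u (k, true)) (N₀ := N₀) hq0 hq1 hc (by
    intro k hk
    have := (hwnear (2 * k) (by omega)).1.le
    rw [hsq, ← hnt, pow_mul] at this
    exact this)
  obtain ⟨D2, hD2, hD2'⟩ := weight_bd (v := fun k => u (k, false)) (N₀ := N₀) hq0 hq1 hc (by
    intro k hk
    have := (hwnear (2 * k) (by omega)).2.le
    rw [hsq, ← hnf, pow_mul] at this
    exact this)
  set K := D1 + D2 with hK
  have hK0 : 0 < K := by positivity
  have hKu : ∀ i, ‖1 - (u i)⁻¹‖ ≤ K * nd q i ^ 2 := by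
    rintro ⟨k, b⟩
    rw [nd_sq]
    cases b
    · refine (hD2' k).1.trans ?_
      gcongr; linarith
    · refine (hD1' k).1.trans ?_
      gcongr; linarith
  have bu : Bd u := by
    refine ⟨K, ?_⟩
    rintro ⟨k, b⟩
    cases b
    · refine (hD2' k).2.trans ?_
      linarith
    · refine (hD1' k).2.trans ?_
      linarith
  have hnd1 : ∀ i, |nd q i| ≤ 1 := fun i => by
    rw [nd_abs hq0]; exact pow_le_one₀ hq0.le hq1.le
  have bf : ∀ n, Bd (fun i => u i * (P n).eval (nd q i : ℂ)) := fun n => bu.mul (bx.poly _)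
  have hEE : ∀ n m, EE (ms A) (fun i => (u i * (P n).eval (nd q i : ℂ)) * (P m).eval (nd q i : ℂ)) =
      if n = m then γ n else 0 := by
    intro n m
    rw [← (horth n m).tsum_eq]
    unfold EE
    rw [tsum_bool' (((bf n).mul (bx.poly _)).summ h0 hμ)]
    refine tsum_congr fun k => ?_
    rw [hAk]
    simp only [hu, hnt, hnf]
    unfold ms
    ring
  have hPorth : ∀ n, ∀ j < n, EE (ms A) (fun i => (u i * (P n).eval (nd q i : ℂ)) *
      (nd q i : ℂ) ^ j) = 0 := by
    intro n j hj
    have := orth_mono h0 hμ (bf n) bx P hmonic hdeg n (fun m hm => by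
      rw [hEE, if_neg (by omega)]) n le_rfl (X ^ j) (by rw [degree_X_pow]; exact_mod_cast hj)
    simpa using this
  obtain ⟨CM, hCM0, hCM⟩ := lemmaM hq0 hq1 hA0 hA1
  -- main comparison
  have hcomp : ∀ m e : ℕ, e ≤ 1 → K * (CM * q ^ (2 * m + e)) ≤ 1 / 2 →
      ‖γ (2 * m + e) - ((2 * baseG (A * (q ^ 2) ^ e) (q ^ 2) m : ℝ) : ℂ)‖ ≤
        2 * K * (CM * q ^ (2 * m + e)) * (2 * baseG (A * (q ^ 2) ^ e) (q ^ 2) m) := by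
    intro m e he hsmall
    obtain ⟨P0, hP0m, hP0d, hP0o, hP0g⟩ := base_poly hq0 hq1 hA0 hA1 m e he
    exact perturb h0 hμ hnd1 hune bu hK0.le hKu (by positivity) hsmall (hCM _) (hmonic _) (hdeg _)
      hP0m hP0d (hPorth _) hP0o (by rw [hEE, if_pos rfl]) hP0g
  set D := 2 * K * CM * q⁻¹ + 2 with hD
  have hD0 : 0 < D := by positivity
  obtain ⟨N, hN⟩ := exists_pow_lt_of_lt_one (show 0 < 1 / (2 * D) by positivity) hq1
  refine ⟨7 * D, by positivity, N, fun n hn hev => ?_⟩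
  obtain ⟨m, rfl⟩ : ∃ m, n = 2 * m + 2 := by
    obtain ⟨k, hk⟩ := hev
    exact ⟨k - 1, by omega⟩
  have hs : D * q ^ (2 * m + 2) ≤ 1 / 2 := by
    have h1 : q ^ (2 * m + 2) ≤ q ^ N := pow_le_pow_of_le_one hq0.le hq1.le (by omega)
    calc D * q ^ (2 * m + 2) ≤ D * (1 / (2 * D)) := by gcongr; linarith
      _ = 1 / 2 := by field_simp
  have hqp : 0 < q ^ (2 * m + 2) := by positivity
  have hs1 : 2 * K * (CM * q ^ (2 * m + 1)) ≤ D * q ^ (2 * m + 2) := by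
    have : 2 * K * (CM * q ^ (2 * m + 1)) = 2 * K * CM * q⁻¹ * q ^ (2 * m + 2) := by
      field_simp
      ring
    rw [this, hD]
    nlinarith
  have hs2 : 2 * K * (CM * q ^ (2 * m + 2)) ≤ D * q ^ (2 * m + 2) := by
    refine le_trans ?_ hs1
    have : q ^ (2 * m + 2) ≤ q ^ (2 * m + 1) := pow_le_pow_of_le_one hq0.le hq1.le (by omega)
    gcongr
  have hp1 : 0 < K * (CM * q ^ (2 * m + 1)) := by positivity
  have hp2 : 0 < K * (CM * q ^ (2 * m + 2)) := by positivity
  have c1 := hcomp m 1 le_rfl (by linarith)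
  have c2 := hcomp (m + 1) 0 (by norm_num) (by
    rw [show 2 * (m + 1) + 0 = 2 * m + 2 by ring]; linarith)
  rw [show 2 * (m + 1) + 0 = 2 * m + 2 by ring, pow_zero, mul_one] at c2
  rw [pow_one] at c1
  have g1pos : 0 < 2 * baseG (A * q ^ 2) (q ^ 2) m := by
    have := baseG_pos (A := A * q ^ 2) (Q := q ^ 2) (by positivity) (by nlinarith) hQ0 hQ1 m
    linarith
  have g2pos : 0 < 2 * baseG A (q ^ 2) (m + 1) := by
    have := baseG_pos hA0 hA1 hQ0 hQ1 (m + 1)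
    linarith
  have hratio : 2 * baseG A (q ^ 2) (m + 1) = 2 * baseG (A * q ^ 2) (q ^ 2) m *
      (A * (q ^ 2) ^ m * ((1 - (q ^ 2) ^ (m + 1)) ^ 2 /
      ((1 - A * (q ^ 2) ^ (2 * m + 1)) * (1 - A * (q ^ 2) ^ (2 * m + 2))))) := by
    rw [baseG_ratio hA0 hA1 hQ0 hQ1 m]
    ring
  have hρ := rho_est hA0 hA1 hQ0 hQ1 m
  generalize (1 - (q ^ 2) ^ (m + 1)) ^ 2 /
      ((1 - A * (q ^ 2) ^ (2 * m + 1)) * (1 - A * (q ^ 2) ^ (2 * m + 2))) = ρ at hρ hratio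
  generalize 2 * baseG (A * q ^ 2) (q ^ 2) m = g1 at *
  generalize 2 * baseG A (q ^ 2) (m + 1) = g2 at *
  have hrp : (q ^ (-(((2 * m + 2 : ℕ) : ℝ) - 1 + α)) : ℝ) = (A * (q ^ 2) ^ m)⁻¹ := by
    rw [Real.rpow_neg hq0.le, hA, ← pow_mul, ← Real.rpow_natCast q (2 * m), ← Real.rpow_add hq0]
    congr 2
    push_cast; ring
  have g1ne : (g1 : ℂ) ≠ 0 := by exact_mod_cast g1pos.ne'
  have g2ne : (g2 : ℂ) ≠ 0 := by exact_mod_cast g2pos.ne'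
  have conv : ∀ (x : ℂ) (g B : ℝ), 0 < g → ‖x - g‖ ≤ B * g → ‖x / g - 1‖ ≤ B := by
    intro x g B hg h
    have hne : (g : ℂ) ≠ 0 := by exact_mod_cast hg.ne'
    have e : x / g - 1 = (x - g) / g := by field_simp
    rw [e, norm_div, Complex.norm_real, Real.norm_of_nonneg hg.le, div_le_iff₀ hg]
    exact h
  have f1 := (conv _ _ _ g1pos c1).trans hs1
  have f2 := (conv _ _ _ g2pos c2).trans hs2
  have fρ : ‖(ρ : ℂ) - 1‖ ≤ D * q ^ (2 * m + 2) := by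
    have : ‖(ρ : ℂ) - 1‖ = |ρ - 1| := by
      rw [← Real.norm_eq_abs, ← Complex.norm_real]; push_cast; rfl
    rw [this]
    refine hρ.trans ?_
    rw [← pow_mul, show 2 * (m + 1) = 2 * m + 2 by ring]
    gcongr
    rw [hD]
    have : 0 < 2 * K * CM * q⁻¹ := by positivity
    linarith
  have hfin := final_est fρ f2 f1 hs
  rw [show 2 * m + 2 - 1 = 2 * m + 1 by omega, hrp, mul_assoc 7]
  refine le_trans (le_of_eq ?_) hfin
  congr 2
  have hAne : (A : ℂ) ≠ 0 := by exact_mod_cast hA0.ne'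
  have hqne : (q : ℂ) ≠ 0 := by exact_mod_cast hq0.ne'
  have hratioC : (g2 : ℂ) = g1 * (A * (q ^ 2) ^ m * ρ) := by exact_mod_cast hratio
  have hρne : (ρ : ℂ) ≠ 0 := by
    intro h; rw [h] at hratioC; simp at hratioC; exact g2ne (by exact_mod_cast hratioC)
  rw [add_sub_cancel, add_sub_cancel, hratioC]
  have hγ1 := hγ (2 * m + 1)
  push_cast
  field_simp
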